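/- Suppose that there exist ε ∈ (0,1] and an integer d ≥ 1 such that for every N ∈ ℕ there is a finite d-monotone bipartite ε-expander with more than N vertices. Then there exists ε' > 0 such that for every N ∈ ℕ there is a finite bipartite ε'-expander with more than N vertices that has maximum degree at most 3 and admits a 2-queue layout. -/

import Mathlib

/-- Monotone matching in a bipartite graph with ordered colour classes `Fin n`, `Fin m`:
a matching no two of whose edges cross (`e`, `f` cross if `e.1 < f.1` and
`f.2 < e.2`). -/
def MonotoneMatching {n m : ℕ} (M : Finset (Fin n × Fin m)) : Prop :=
  (∀ e ∈ M, ∀ f ∈ M, e ≠ f → e.1 ≠ f.1 ∧ e.2 ≠ f.2) ∧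
  (∀ e ∈ M, ∀ f ∈ M, ¬(e.1 < f.1 ∧ f.2 < e.2))

/-- A bipartite graph with ordered colour classes is `d`-monotone if its edge set is
the union of `d` monotone matchings. -/
def IsMonotoneGraph {n m : ℕ} (E : Finset (Fin n × Fin m)) (d : ℕ) : Prop :=
  ∃ M : Fin d → Finset (Fin n × Fin m),
    (∀ t, MonotoneMatching (M t)) ∧ E = Finset.univ.biUnion M

/-- The neighbourhood of a set `S` of vertices of the first colour class. -/
def nbhdA {n m : ℕ} (E : Finset (Fin n × Fin m)) (S : Finset (Fin n)) : Finset (Fin m) :=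
  (E.filter (fun e => e.1 ∈ S)).image Prod.snd

/-- A bipartite graph with colour classes of equal size `n` is a bipartite
`ε`-expander if `|N(S)| ≥ (1+ε)|S|` for every `S ⊆ A` with `|S| ≤ |A|/2`. -/
def BipExpander {n : ℕ} (E : Finset (Fin n × Fin n)) (ε : ℝ) : Prop :=
  ∀ S : Finset (Fin n), (S.card : ℝ) ≤ (n : ℝ) / 2 →
    (1 + ε) * (S.card : ℝ) ≤ ((nbhdA E S).card : ℝ)

/-- The graph with edge set `E` has maximum degree at most `D`. -/
def MaxDegreeLe {n m : ℕ} (E : Finset (Fin n × Fin m)) (D : ℕ) : Prop :=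
  (∀ i : Fin n, (E.filter (fun e => e.1 = i)).card ≤ D) ∧
  (∀ j : Fin m, (E.filter (fun e => e.2 = j)).card ≤ D)

/-- The edge with endpoint positions `{c,d}` is nested inside the one with endpoint
positions `{a,b}`, or vice versa. -/
def NestNat (a b c d : ℕ) : Prop :=
  (min a b < min c d ∧ max c d < max a b) ∨ (min c d < min a b ∧ max a b < max c d)

/-- A `p`-queue layout of the bipartite graph with edge set `E`: a linear order of the
vertices (an injection into `ℕ`) together with a partition of `E` into `p` parts, no
two edges of one part being nested. -/
def HasQueueLayout {n m : ℕ} (E : Finset (Fin n × Fin m)) (p : ℕ) : Prop :=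
  ∃ σ : (Fin n ⊕ Fin m) → ℕ, Function.Injective σ ∧
    ∃ J : Fin p → Finset (Fin n × Fin m),
      (∀ s t, s ≠ t → Disjoint (J s) (J t)) ∧
      Finset.univ.biUnion J = E ∧
      ∀ t, ∀ e ∈ J t, ∀ f ∈ J t,
        ¬NestNat (σ (.inl e.1)) (σ (.inr e.2)) (σ (.inl f.1)) (σ (.inr f.2))

open Fin.CommRing in
/-- On a cycle, a set which contains `x` at one place but not at another is entered
by `x` somewhere along the cycle. -/
lemma exists_mem_succ_notMem {m : ℕ} [NeZero m] {α : Type*} (S : Fin m → Finset α)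
    {s t : Fin m} {x : α} (hs : x ∈ S s) (ht : x ∉ S t) :
    ∃ u, x ∈ S (u + 1) ∧ x ∉ S u := by
  by_contra! hc
  have key : ∀ k : ℕ, x ∉ S (t + (k : Fin m)) := by
    intro k
    induction k with
    | zero => simpa using ht
    | succ k ih =>
      intro hx
      refine ih (hc _ ?_)
      rwa [add_assoc, ← Nat.cast_succ]
  refine key (s - t).val ?_
  rwa [Fin.cast_val_eq_self, add_sub_cancel]

lemma card_nbhdA_le_of_monotoneMatching {n m : ℕ} {M : Finset (Fin n × Fin m)}
    (hM : MonotoneMatching M) (D : Finset (Fin n)) : (nbhdA M D).card ≤ D.card := by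
  refine Finset.card_image_le.trans (Finset.card_le_card_of_injOn Prod.fst ?_ ?_)
  · intro e he
    exact (Finset.mem_filter.mp he).2
  · intro e he f hf hef
    by_contra hne
    exact (hM.1 e (Finset.mem_filter.mp he).1 f (Finset.mem_filter.mp hf).1 hne).1 hef

/-- Expansion of a cyclic arrangement of copies of `Fin n`, in which consecutive copies are
joined by identity matchings and the matchings `M u` are placed at the positions `c u`. -/
lemma cyclic_expansion {m d n : ℕ} [NeZero m] {ε : ℝ} (hε0 : 0 < ε) (hε1 : ε ≤ 1)
    (M : Fin d → Finset (Fin n × Fin n)) (hM : ∀ u, MonotoneMatching (M u))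
    (hE : BipExpander (Finset.univ.biUnion M) ε) (c : Fin d → Fin m)
    (S W : Fin m → Finset (Fin n)) (hself : ∀ t, S t ⊆ W t) (hsucc : ∀ t, S (t + 1) ⊆ W t)
    (hmatch : ∀ u, ∀ e ∈ M u, e.1 ∈ S (c u) → e.2 ∈ W (c u))
    (hcard : ((∑ t, (S t).card : ℕ) : ℝ) ≤ (m * n : ℝ) / 2) :
    (1 + ε / (m * (d + 2))) * ((∑ t, (S t).card : ℕ) : ℝ) ≤ ((∑ t, (W t).card : ℕ) : ℝ) := by
  have hm : 0 < m := Nat.pos_of_ne_zero (NeZero.ne m)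
  have hmR : (0 : ℝ) < m := by exact_mod_cast hm
  set D : Finset (Fin n) := Finset.univ.biUnion fun t => W t \ S t with hD
  have hDcard : D.card + ∑ t, (S t).card ≤ ∑ t, (W t).card := by
    calc D.card + ∑ t, (S t).card ≤ ∑ t, (W t \ S t).card + ∑ t, (S t).card := by
          gcongr; exact Finset.card_biUnion_le
      _ = ∑ t, (W t).card := by
          rw [← Finset.sum_add_distrib]
          exact Finset.sum_congr rfl fun t _ => Finset.card_sdiff_add_card_eq_card (hself t)
  have hdiff : ∀ s t, ∀ x, x ∈ S s → x ∉ S t → x ∈ D := by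
    intro s t x hs ht
    obtain ⟨u, hu, hu'⟩ := exists_mem_succ_notMem S hs ht
    exact Finset.mem_biUnion.mpr ⟨u, Finset.mem_univ _,
      Finset.mem_sdiff.mpr ⟨hsucc u hu, hu'⟩⟩
  obtain ⟨s, -, hs⟩ := Finset.exists_min_image Finset.univ (fun t => (S t).card)
    ⟨(0 : Fin m), Finset.mem_univ _⟩
  have hle : ∀ t, (S t).card ≤ (S s).card + D.card := by
    intro t
    have hsub : S t ⊆ S s ∪ D := by
      intro x hx
      by_cases hxs : x ∈ S s
      · exact Finset.mem_union_left _ hxs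
      · exact Finset.mem_union_right _ (hdiff t s x hx hxs)
    exact (Finset.card_le_card hsub).trans (Finset.card_union_le _ _)
  have hupper : ∑ t, (S t).card ≤ m * ((S s).card + D.card) := by
    simpa using Finset.sum_le_sum fun t (_ : t ∈ Finset.univ) => hle t
  have hlower : m * (S s).card ≤ ∑ t, (S t).card := by
    simpa using Finset.sum_le_sum fun t (ht : t ∈ Finset.univ) => hs t ht
  have hhalf : ((S s).card : ℝ) ≤ (n : ℝ) / 2 := by
    have h1 : (m : ℝ) * (S s).card ≤ ((∑ t, (S t).card : ℕ) : ℝ) := by exact_mod_cast hlower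
    have h2 : (m : ℝ) * (S s).card ≤ m * ((n : ℝ) / 2) := by linarith
    exact le_of_mul_le_mul_left h2 hmR
  have hN : (nbhdA (Finset.univ.biUnion M) (S s)).card ≤
      (S s).card + (D.card + d * D.card) := by
    have hsub : nbhdA (Finset.univ.biUnion M) (S s) ⊆
        S s ∪ (D ∪ Finset.univ.biUnion fun u => nbhdA (M u) D) := by
      intro j hj
      obtain ⟨e, he, rfl⟩ := Finset.mem_image.mp hj
      obtain ⟨heE, hes⟩ := Finset.mem_filter.mp he
      obtain ⟨u, -, hu⟩ := Finset.mem_biUnion.mp heE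
      by_cases h1 : e.2 ∈ S s
      · exact Finset.mem_union_left _ h1
      refine Finset.mem_union_right _ ?_
      by_cases h2 : e.1 ∈ S (c u)
      · refine Finset.mem_union_left _ ?_
        by_cases h3 : e.2 ∈ S (c u)
        · exact hdiff _ _ _ h3 h1
        · exact Finset.mem_biUnion.mpr ⟨c u, Finset.mem_univ _,
            Finset.mem_sdiff.mpr ⟨hmatch u e hu h2, h3⟩⟩
      · refine Finset.mem_union_right _ (Finset.mem_biUnion.mpr ⟨u, Finset.mem_univ _, ?_⟩)
        exact Finset.mem_image.mpr
          ⟨e, Finset.mem_filter.mpr ⟨hu, hdiff _ _ _ hes h2⟩, rfl⟩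
    refine (Finset.card_le_card hsub).trans ((Finset.card_union_le _ _).trans ?_)
    gcongr
    refine (Finset.card_union_le _ _).trans ?_
    gcongr
    refine Finset.card_biUnion_le.trans ?_
    simpa using Finset.sum_le_sum fun u (_ : u ∈ Finset.univ) =>
      card_nbhdA_le_of_monotoneMatching (hM u) D
  have hexp := hE (S s) hhalf
  have hN' : ((nbhdA (Finset.univ.biUnion M) (S s)).card : ℝ) ≤
      (S s).card + (D.card + d * D.card) := by exact_mod_cast hN
  have hD' : (D.card : ℝ) + ((∑ t, (S t).card : ℕ) : ℝ) ≤ ((∑ t, (W t).card : ℕ) : ℝ) := by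
    exact_mod_cast hDcard
  have hup' : ((∑ t, (S t).card : ℕ) : ℝ) ≤ m * ((S s).card + D.card) := by
    exact_mod_cast hupper
  have hDnn : (0 : ℝ) ≤ D.card := Nat.cast_nonneg _
  suffices h : ε / (m * (d + 2)) * ((∑ t, (S t).card : ℕ) : ℝ) ≤ D.card by linarith
  rw [div_mul_eq_mul_div, div_le_iff₀ (by positivity)]
  calc ε * ((∑ t, (S t).card : ℕ) : ℝ) ≤ ε * (m * ((S s).card + D.card)) := by gcongr
    _ = m * (ε * (S s).card + ε * D.card) := by ring
    _ ≤ m * ((D.card + d * D.card) + 1 * D.card) := by gcongr; linarith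
    _ = D.card * (m * (d + 2)) := by ring

lemma card_eq_sum_card_slice {m n k : ℕ} (e : Fin m × Fin n ≃ Fin k) (X : Finset (Fin k)) :
    X.card = ∑ t, (Finset.univ.filter fun i => e (t, i) ∈ X).card := by
  simp_rw [Finset.card_filter]
  rw [← Fintype.sum_prod_type' (f := fun t i => if e (t, i) ∈ X then 1 else 0),
    Equiv.sum_comp e fun p => if p ∈ X then 1 else 0]
  simp

/-- Two edges between consecutive layers of size `K` are not nested if they do not cross. -/
lemma not_nestNat_of_layers {K a b c d p x y q z w : ℕ}
    (h1 : min a b = p * K + x) (h2 : max a b = (p + 1) * K + y)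
    (h3 : min c d = q * K + z) (h4 : max c d = (q + 1) * K + w)
    (hx : x < K) (hy : y < K) (hz : z < K) (hw : w < K)
    (hcross : p = q → ¬(x < z ∧ w < y) ∧ ¬(z < x ∧ y < w)) : ¬NestNat a b c d := by
  rw [NestNat, h1, h2, h3, h4]
  rcases lt_trichotomy p q with hpq | rfl | hpq
  · have : (p + 1) * K ≤ q * K := Nat.mul_le_mul_right K hpq
    simp only [add_mul, one_mul] at *
    omega
  · have := hcross rfl
    omega
  · have : (q + 1) * K ≤ p * K := Nat.mul_le_mul_right K hpq
    simp only [add_mul, one_mul] at *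
    omega

/-- The layer of the `x`-th class of a cycle of `4 * d + 4` classes, folded so that
adjacent classes lie in adjacent layers. -/
def foldLayer (d x : ℕ) : ℕ := min x (4 * d + 4 - x)

/-- Whether the `x`-th class of a cycle of `4 * d + 4` classes lies on the returning side. -/
def foldSide (d x : ℕ) : ℕ := if x ≤ 2 * d + 2 then 0 else 1

/-- The position of the `i`-th vertex of the `x`-th class in the folded vertex order. -/
def foldPos (d n x i : ℕ) : ℕ := foldLayer d x * (2 * n) + (2 * i + foldSide d x)

lemma foldSide_le (d x : ℕ) : foldSide d x ≤ 1 := by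
  unfold foldSide; split_ifs <;> omega

lemma foldPos_injective {d n x y i j : ℕ} (hx : x < 4 * d + 4) (hy : y < 4 * d + 4)
    (hi : i < n) (hj : j < n) (h : foldPos d n x i = foldPos d n y j) : x = y ∧ i = j := by
  have hsx := foldSide_le d x
  have hsy := foldSide_le d y
  have hr : 2 * i + foldSide d x = 2 * j + foldSide d y := by
    have := congrArg (· % (2 * n)) h
    simp only [foldPos] at this
    rwa [Nat.mul_add_mod', Nat.mul_add_mod', Nat.mod_eq_of_lt (by omega),
      Nat.mod_eq_of_lt (by omega)] at this
  have hl : foldLayer d x = foldLayer d y := by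
    have : foldLayer d x * (2 * n) = foldLayer d y * (2 * n) := by
      unfold foldPos at h; omega
    exact Nat.eq_of_mul_eq_mul_right (by omega) this
  have hs : foldSide d x = foldSide d y := by omega
  refine ⟨?_, by omega⟩
  unfold foldLayer at hl
  unfold foldSide at hs
  split_ifs at hs <;> omega

/-- Identity edges between adjacent classes join corresponding positions of adjacent layers. -/
lemma foldPos_adjacent {d n x y i : ℕ} (hi : i < n) (hx : x < 4 * d + 4) (hy : y < 4 * d + 4)
    (hxy : y = x + 1 ∨ x = y + 1 ∨ (x = 0 ∧ y = 4 * d + 3)) :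
    ∃ p b c, b ≤ 1 ∧ c ≤ 1 ∧ (p = 2 * d + 1 → c ≤ b) ∧ (p ≠ 2 * d + 1 → b ≤ c) ∧
      min (foldPos d n x i) (foldPos d n y i) = p * (2 * n) + (2 * i + b) ∧
      max (foldPos d n x i) (foldPos d n y i) = (p + 1) * (2 * n) + (2 * i + c) := by
  have hsx := foldSide_le d x
  have hsy := foldSide_le d y
  have hlay : (foldLayer d y = foldLayer d x + 1 ∧
      (foldLayer d x = 2 * d + 1 → foldSide d y ≤ foldSide d x) ∧
      (foldLayer d x ≠ 2 * d + 1 → foldSide d x ≤ foldSide d y)) ∨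
      (foldLayer d x = foldLayer d y + 1 ∧
      (foldLayer d y = 2 * d + 1 → foldSide d x ≤ foldSide d y) ∧
      (foldLayer d y ≠ 2 * d + 1 → foldSide d y ≤ foldSide d x)) := by
    unfold foldLayer foldSide
    split_ifs <;> omega
  rcases hlay with ⟨h, h1, h2⟩ | ⟨h, h1, h2⟩
  · refine ⟨foldLayer d x, foldSide d x, foldSide d y, hsx, hsy, h1, h2, ?_, ?_⟩ <;>
    · simp only [foldPos, h, add_mul, one_mul]
      omega
  · refine ⟨foldLayer d y, foldSide d y, foldSide d x, hsy, hsx, h1, h2, ?_, ?_⟩ <;>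
    · simp only [foldPos, h, add_mul, one_mul]
      omega

lemma foldPos_matching {d n s i j : ℕ} (hi : i < n) (hs : s ≤ d) :
    min (foldPos d n (2 * s) i) (foldPos d n (2 * s + 1) j) = 2 * s * (2 * n) + 2 * i ∧
    max (foldPos d n (2 * s) i) (foldPos d n (2 * s + 1) j) =
      (2 * s + 1) * (2 * n) + 2 * j := by
  have h1 : foldLayer d (2 * s) = 2 * s := by unfold foldLayer; omega
  have h2 : foldLayer d (2 * s + 1) = 2 * s + 1 := by unfold foldLayer; omega
  have h3 : foldSide d (2 * s) = 0 := by unfold foldSide; split_ifs <;> omega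
  have h4 : foldSide d (2 * s + 1) = 0 := by unfold foldSide; split_ifs <;> omega
  simp only [foldPos, h1, h2, h3, h4, add_mul, one_mul]
  omega

/-- Identity edges of the cyclic graph: the `s`-th class on the left is joined to
the `s`-th and the preceding class on the right. -/
def CycleEdge {m n : ℕ} [NeZero m] (a b : Fin m × Fin n) : Prop :=
  a.2 = b.2 ∧ (a.1 = b.1 ∨ a.1 = b.1 + 1)

/-- The matching `M u` placed between the `(u + 1)`-st classes. -/
def MatchingEdge {m d n : ℕ} (M : Fin d → Finset (Fin n × Fin n)) (a b : Fin m × Fin n) :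
    Prop :=
  a.1 = b.1 ∧ ∃ u : Fin d, a.1.val = u.val + 1 ∧ (a.2, b.2) ∈ M u

lemma CycleEdge.adjacent {d n : ℕ} {a b : Fin (2 * d + 2) × Fin n} (h : CycleEdge a b) :
    2 * b.1.val + 1 = 2 * a.1.val + 1 ∨ 2 * a.1.val = (2 * b.1.val + 1) + 1 ∨
      (2 * a.1.val = 0 ∧ 2 * b.1.val + 1 = 4 * d + 3) := by
  rcases h.2 with h | h
  · left; rw [h]
  · right
    have hb := b.1.isLt
    rw [h, Fin.val_add_one]
    simp only [Fin.ext_iff, Fin.val_last]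
    split_ifs <;> omega

lemma MatchingEdge.right_unique {m d n : ℕ} {M : Fin d → Finset (Fin n × Fin n)}
    (hM : ∀ u, MonotoneMatching (M u)) {a b b' : Fin m × Fin n} (h : MatchingEdge M a b)
    (h' : MatchingEdge M a b') : b = b' := by
  obtain ⟨h1, u, hu, hm⟩ := h
  obtain ⟨h1', u', hu', hm'⟩ := h'
  obtain rfl : u = u' := Fin.ext (by omega)
  refine Prod.ext (h1.symm.trans h1') ?_
  by_contra hne
  exact ((hM u).1 _ hm _ hm' (fun h => hne (Prod.ext_iff.mp h).2)).1 rfl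

lemma MatchingEdge.left_unique {m d n : ℕ} {M : Fin d → Finset (Fin n × Fin n)}
    (hM : ∀ u, MonotoneMatching (M u)) {a a' b : Fin m × Fin n} (h : MatchingEdge M a b)
    (h' : MatchingEdge M a' b) : a = a' := by
  obtain ⟨h1, u, hu, hm⟩ := h
  obtain ⟨h1', u', hu', hm'⟩ := h'
  obtain rfl : u = u' := Fin.ext (by rw [h1] at hu; rw [h1'] at hu'; omega)
  refine Prod.ext (h1.trans h1'.symm) ?_
  by_contra hne
  exact ((hM u).1 _ hm _ hm' (fun h => hne (Prod.ext_iff.mp h).1)).2 rfl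

lemma card_le_three_of_cover {α : Type*} [DecidableEq α] {X : Finset α} {x y : α}
    {P : α → Prop} (hX : ∀ z ∈ X, z = x ∨ z = y ∨ P z) (hP : ∀ z w, P z → P w → z = w) :
    X.card ≤ 3 := by
  classical
  have hsub : X ⊆ {x, y} ∪ X.filter P := by
    intro z hz
    rcases hX z hz with h | h | h
    · simp [h]
    · simp [h]
    · simp [hz, h]
  refine (Finset.card_le_card hsub).trans ((Finset.card_union_le _ _).trans ?_)
  have h1 : ({x, y} : Finset α).card ≤ 2 := Finset.card_le_two
  have h2 : (X.filter P).card ≤ 1 := Finset.card_le_one.mpr fun z hz w hw =>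
    hP z w (Finset.mem_filter.mp hz).2 (Finset.mem_filter.mp hw).2
  omega

open Classical in
/-- The graph whose edges are the identity edges around the cycle and the placed matchings. -/
noncomputable def cyclicGraph {m d n k : ℕ} [NeZero m] (e : Fin m × Fin n ≃ Fin k)
    (M : Fin d → Finset (Fin n × Fin n)) : Finset (Fin k × Fin k) :=
  Finset.univ.filter fun p => CycleEdge (e.symm p.1) (e.symm p.2) ∨
    MatchingEdge M (e.symm p.1) (e.symm p.2)

lemma mem_cyclicGraph {m d n k : ℕ} [NeZero m] {e : Fin m × Fin n ≃ Fin k}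
    {M : Fin d → Finset (Fin n × Fin n)} {p : Fin k × Fin k} :
    p ∈ cyclicGraph e M ↔ CycleEdge (e.symm p.1) (e.symm p.2) ∨
      MatchingEdge M (e.symm p.1) (e.symm p.2) := by
  simp [cyclicGraph]

lemma cyclicGraph_maxDegreeLe {m d n k : ℕ} [NeZero m] (e : Fin m × Fin n ≃ Fin k)
    {M : Fin d → Finset (Fin n × Fin n)} (hM : ∀ u, MonotoneMatching (M u)) :
    MaxDegreeLe (cyclicGraph e M) 3 := by
  constructor
  · intro i
    refine card_le_three_of_cover (x := (i, e ((e.symm i).1, (e.symm i).2)))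
      (y := (i, e ((e.symm i).1 - 1, (e.symm i).2)))
      (P := fun p => p.1 = i ∧ MatchingEdge M (e.symm p.1) (e.symm p.2)) ?_ ?_
    · rintro ⟨p, q⟩ hp
      obtain ⟨hpG, rfl⟩ := Finset.mem_filter.mp hp
      rcases mem_cyclicGraph.mp hpG with ⟨h2, h1 | h1⟩ | h
      · left
        exact Prod.ext rfl (e.symm_apply_eq.mp (Prod.ext h1.symm h2.symm))
      · right; left
        exact Prod.ext rfl (e.symm_apply_eq.mp
          (Prod.ext (eq_sub_of_add_eq h1.symm) h2.symm))
      · exact Or.inr (Or.inr ⟨rfl, h⟩)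
    · rintro ⟨p, q⟩ ⟨p', q'⟩ ⟨rfl, h⟩ ⟨h1, h'⟩
      dsimp only at h1 h h'
      subst h1
      exact Prod.ext rfl (e.symm.injective (h.right_unique hM h'))
  · intro i
    refine card_le_three_of_cover (x := (e ((e.symm i).1, (e.symm i).2), i))
      (y := (e ((e.symm i).1 + 1, (e.symm i).2), i))
      (P := fun p => p.2 = i ∧ MatchingEdge M (e.symm p.1) (e.symm p.2)) ?_ ?_
    · rintro ⟨p, q⟩ hp
      obtain ⟨hpG, rfl⟩ := Finset.mem_filter.mp hp
      rcases mem_cyclicGraph.mp hpG with ⟨h2, h1 | h1⟩ | h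
      · left
        exact Prod.ext (e.symm_apply_eq.mp (Prod.ext h1 h2)) rfl
      · right; left
        exact Prod.ext (e.symm_apply_eq.mp (Prod.ext h1 h2)) rfl
      · exact Or.inr (Or.inr ⟨rfl, h⟩)
    · rintro ⟨p, q⟩ ⟨p', q'⟩ ⟨rfl, h⟩ ⟨h1, h'⟩
      dsimp only at h1 h h'
      subst h1
      exact Prod.ext (e.symm.injective (h.left_unique hM h')) rfl

lemma cyclicGraph_bipExpander {d n k : ℕ} {ε : ℝ} (hε0 : 0 < ε) (hε1 : ε ≤ 1)
    (e : Fin (2 * d + 2) × Fin n ≃ Fin k) {M : Fin d → Finset (Fin n × Fin n)}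
    (hM : ∀ u, MonotoneMatching (M u)) (hE : BipExpander (Finset.univ.biUnion M) ε) :
    BipExpander (cyclicGraph e M) (ε / ((2 * d + 2 : ℕ) * (d + 2))) := by
  intro S hS
  have hk : k = (2 * d + 2) * n := by simpa using (Fintype.card_congr e).symm
  have hnb : ∀ a b, a ∈ S → CycleEdge (e.symm a) b ∨ MatchingEdge M (e.symm a) b →
      e b ∈ nbhdA (cyclicGraph e M) S := by
    intro a b ha hab
    refine Finset.mem_image.mpr ⟨(a, e b), Finset.mem_filter.mpr ⟨?_, ha⟩, rfl⟩
    rw [mem_cyclicGraph]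
    simpa using hab
  rw [card_eq_sum_card_slice e S, card_eq_sum_card_slice e (nbhdA _ S)]
  refine cyclic_expansion hε0 hε1 M hM hE (fun u => ⟨u.val + 1, by omega⟩) _ _ ?_ ?_ ?_ ?_
  · intro t i hi
    refine Finset.mem_filter.mpr ⟨Finset.mem_univ _, ?_⟩
    refine hnb _ _ (Finset.mem_filter.mp hi).2 (Or.inl ?_)
    simp [CycleEdge]
  · intro t i hi
    refine Finset.mem_filter.mpr ⟨Finset.mem_univ _, ?_⟩
    refine hnb _ _ (Finset.mem_filter.mp hi).2 (Or.inl ?_)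
    simp [CycleEdge]
  · intro u f hf hi
    refine Finset.mem_filter.mpr ⟨Finset.mem_univ _, ?_⟩
    refine hnb _ _ (Finset.mem_filter.mp hi).2 (Or.inr ?_)
    rw [Equiv.symm_apply_apply]
    exact ⟨rfl, u, rfl, hf⟩
  · rw [← card_eq_sum_card_slice e S]
    have hkR : (k : ℝ) = (2 * d + 2 : ℕ) * n := by exact_mod_cast hk
    rwa [hkR] at hS

lemma cyclicGraph_hasQueueLayout {d n k : ℕ} (e : Fin (2 * d + 2) × Fin n ≃ Fin k)
    {M : Fin d → Finset (Fin n × Fin n)} (hM : ∀ u, MonotoneMatching (M u)) :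
    HasQueueLayout (cyclicGraph e M) 2 := by
  classical
  refine ⟨Sum.elim
      (fun a => foldPos d n (2 * (e.symm a).1.val) (e.symm a).2.val)
      (fun b => foldPos d n (2 * (e.symm b).1.val + 1) (e.symm b).2.val), ?_,
    ![(cyclicGraph e M).filter fun p => CycleEdge (e.symm p.1) (e.symm p.2),
      (cyclicGraph e M).filter fun p => ¬CycleEdge (e.symm p.1) (e.symm p.2)], ?_, ?_, ?_⟩
  · rintro (a | a) (b | b) hab <;> simp only [Sum.elim_inl, Sum.elim_inr] at hab <;>
      have := foldPos_injective (by omega) (by omega) (Fin.isLt _) (Fin.isLt _) hab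
    · exact congrArg _ (e.symm.injective
        (Prod.ext (Fin.ext (by omega)) (Fin.ext this.2)))
    · omega
    · omega
    · exact congrArg _ (e.symm.injective
        (Prod.ext (Fin.ext (by omega)) (Fin.ext this.2)))
  · have hdis := Finset.disjoint_filter_filter_not (cyclicGraph e M) (cyclicGraph e M)
      fun p => CycleEdge (e.symm p.1) (e.symm p.2)
    intro s t hst
    fin_cases s <;> fin_cases t
    · exact absurd rfl hst
    · exact hdis
    · exact hdis.symm
    · exact absurd rfl hst
  · ext p
    simp only [Finset.mem_biUnion, Finset.mem_univ, true_and, Fin.exists_fin_two,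
      Matrix.cons_val_zero, Matrix.cons_val_one, Finset.mem_filter]
    tauto
  · rw [Fin.forall_fin_two]
    constructor
    · rintro ⟨a, b⟩ hp ⟨a', b'⟩ hq
      simp only [Matrix.cons_val_zero, Finset.mem_filter] at hp hq
      simp only [Sum.elim_inl, Sum.elim_inr]
      obtain ⟨p, x, y, hx, hy, h1, h2, h3, h4⟩ := foldPos_adjacent (n := n)
        (e.symm a).2.isLt (by omega) (by omega) hp.2.adjacent
      obtain ⟨q, z, w, hz, hw, h1', h2', h3', h4'⟩ := foldPos_adjacent (n := n)
        (e.symm a').2.isLt (by omega) (by omega) hq.2.adjacent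
      rw [← hp.2.1, ← hq.2.1]
      refine not_nestNat_of_layers h3 h4 h3' h4' ?_ ?_ ?_ ?_ ?_ <;> omega
    · rintro ⟨a, b⟩ hp ⟨a', b'⟩ hq
      simp only [Matrix.cons_val_one, Matrix.cons_val_zero, Finset.mem_filter,
        mem_cyclicGraph] at hp hq
      simp only [Sum.elim_inl, Sum.elim_inr]
      obtain ⟨hs, u, hu, hm⟩ := hp.1.resolve_left hp.2
      obtain ⟨hs', u', hu', hm'⟩ := hq.1.resolve_left hq.2
      rw [← hs, ← hs']
      obtain ⟨h1, h2⟩ := foldPos_matching (d := d) (j := (e.symm b).2.val)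
        (e.symm a).2.isLt (by omega : (e.symm a).1.val ≤ d)
      obtain ⟨h1', h2'⟩ := foldPos_matching (d := d) (j := (e.symm b').2.val)
        (e.symm a').2.isLt (by omega : (e.symm a').1.val ≤ d)
      refine not_nestNat_of_layers h1 h2 h1' h2' (by omega) (by omega) (by omega) (by omega)
        fun hpq => ?_
      obtain rfl : u = u' := Fin.ext (by omega)
      have k1 := (hM u).2 _ hm _ hm'
      have k2 := (hM u).2 _ hm' _ hm
      simp only [Fin.lt_def] at k1 k2
      omega

/-- If there is an infinite family of `d`-monotone bipartite `ε`-expanders, then there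
is an infinite family of bipartite `ε'`-expanders with maximum degree at most `3`
admitting 2-queue layouts, for some `ε' > 0`. -/
theorem stmt14 (ε : ℝ) (hε0 : 0 < ε) (hε1 : ε ≤ 1) (d : ℕ) (hd : 1 ≤ d)
    (h : ∀ N : ℕ, ∃ n : ℕ, N < 2 * n ∧ ∃ E : Finset (Fin n × Fin n),
      IsMonotoneGraph E d ∧ BipExpander E ε) :
    ∃ ε' : ℝ, 0 < ε' ∧ ∀ N : ℕ, ∃ n : ℕ, N < 2 * n ∧
      ∃ E : Finset (Fin n × Fin n), BipExpander E ε' ∧ MaxDegreeLe E 3 ∧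
        HasQueueLayout E 2 := by
  refine ⟨ε / ((2 * d + 2 : ℕ) * (d + 2)), by positivity, fun N => ?_⟩
  obtain ⟨n, hn, E, ⟨M, hM, rfl⟩, hE⟩ := h N
  refine ⟨(2 * d + 2) * n, by nlinarith, cyclicGraph finProdFinEquiv M,
    cyclicGraph_bipExpander hε0 hε1 _ hM hE, cyclicGraph_maxDegreeLe _ hM,
    cyclicGraph_hasQueueLayout _ hM⟩
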